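/- Let C be an abelian category that has countable coproducts and in which countable filtered colimits exist and are exact, and let X be a cochain complex over C. Then the canonical morphism hocolim τ_{≤ i}X ⟶ X, induced by the inclusions of the canonical truncations τ_{≤ i}X into X, is a quasi-isomorphism. -/

import Mathlib

/-!
STATEMENT 15: Let C be an abelian category that has countable coproducts and in which
countable filtered colimits exist and are exact, and let X be a cochain complex over C.
Then the canonical morphism hocolim τ_{≤ i}X ⟶ X, induced by the inclusions of the
canonical truncations τ_{≤ i}X into X, is a quasi-isomorphism.

The tower of canonical truncations of `X` is encoded as a functor `T : ℕ ⥤ CochainComplex C ℤ`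
together with a natural transformation `ι` to the constant functor `X` such that, for each `i`,
`ι.app i : T.obj i ⟶ X` is degreewise an isomorphism in degrees `< i`, the complex `T.obj i`
vanishes in degrees `> i`, and in degree `i` the component of `ι.app i` is a kernel of
`d^i : X^i ⟶ X^{i+1}`; this characterizes the subcomplexes `τ_{≤ i}X ⊆ X` and their
inclusions.
-/

open CategoryTheory Limits CochainComplex HomComplex

universe v u

noncomputable section

variable {C : Type u} [Category.{v} C] [Abelian C] [HasCountableCoproducts C]

/-- The countable coproduct of the terms of a sequence of cochain complexes. -/
abbrev seqCoprod (T : ℕ ⥤ CochainComplex C ℤ) : CochainComplex C ℤ := ∐ (fun i => T.obj i)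

/-- The morphism `v : ⊕ᵢ τ_{≤ i}X ⟶ ⊕ᵢ τ_{≤ i}X` whose component on the `i`-th summand is
(the canonical inclusion) minus (the canonical inclusion of the `(i+1)`-st summand) ∘
(the transition map). -/
def seqMap (T : ℕ ⥤ CochainComplex C ℤ) : seqCoprod T ⟶ seqCoprod T :=
  Sigma.desc (fun i => Sigma.ι (fun j => T.obj j) i -
    T.map (homOfLE (Nat.le_succ i)) ≫ Sigma.ι (fun j => T.obj j) (i + 1))

/-- The homotopy colimit of a sequence of cochain complexes: the mapping cone of `v`. -/
def seqHocolim (T : ℕ ⥤ CochainComplex C ℤ) : CochainComplex C ℤ := mappingCone (seqMap T)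

lemma seqMap_comp_desc {X : CochainComplex C ℤ} (T : ℕ ⥤ CochainComplex C ℤ)
    (ι : T ⟶ (Functor.const ℕ).obj X) :
    seqMap T ≫ Sigma.desc (fun i => ι.app i) = 0 := by
  ext i
  have := ι.naturality (homOfLE (Nat.le_succ i))
  simp only [Functor.const_obj_obj, Functor.const_obj_map, Category.comp_id] at this
  simp [seqMap, this]

/-- The canonical morphism `hocolim τ_{≤ i}X ⟶ X` induced by the inclusions
`τ_{≤ i}X ⟶ X` (and by zero on the shifted first summand of the mapping cone). -/
def hocolimTruncToSelf {X : CochainComplex C ℤ} (T : ℕ ⥤ CochainComplex C ℤ)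
    (ι : T ⟶ (Functor.const ℕ).obj X) : seqHocolim T ⟶ X :=
  mappingCone.desc (seqMap T) 0 (Sigma.desc (fun i => ι.app i))
    (by rw [δ_zero, seqMap_comp_desc, Cochain.ofHom_zero])

/-- The recursion `rᵢ = eᵢ + φᵢ ≫ rᵢ₊₁` along a sequence that is constant from `m` on has a
solution with `r_m = 0`. -/
lemma exists_solution_of_isIso_ge {D : Type*} [Category* D] [Preadditive D] {S : D} (m : ℕ) :
    ∀ {A : ℕ → D} (φ : ∀ i, A i ⟶ A (i + 1)) (_ : ∀ i, m ≤ i → IsIso (φ i))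
      (e : ∀ i, A i ⟶ S),
      ∃ r : ∀ i, A i ⟶ S, (∀ i, r i = e i + φ i ≫ r (i + 1)) ∧ r m = 0 := by
  induction m with
  | zero =>
    intro A φ hφ e
    have (i : ℕ) : IsIso (φ i) := hφ i i.zero_le
    exact ⟨fun i => Nat.rec (motive := fun i => A i ⟶ S) 0
      (fun i r => inv (φ i) ≫ (r - e i)) i, fun i => by simp, rfl⟩
  | succ m ih =>
    intro A φ hφ e
    obtain ⟨r, hr, hm⟩ := ih (A := fun i => A (i + 1)) (fun i => φ (i + 1))
      (fun i hi => hφ (i + 1) (by lia)) (fun i => e (i + 1))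
    refine ⟨fun i => Nat.casesOn (motive := fun i => A i ⟶ S) i (e 0 + φ 0 ≫ r 0) r, ?_, hm⟩
    rintro (_ | i)
    · rfl
    · exact hr i

/-- If `X` receives compatible maps from a sequence `A` which are isomorphisms from some index
on, then the telescope sequence `⨁ A ⟶ ⨁ A ⟶ X` is split exact. -/
lemma nonempty_splitting_telescope {D : Type*} [Category* D] [Preadditive D]
    (S : ShortComplex D) {A : ℕ → D} (φ : ∀ i, A i ⟶ A (i + 1)) (a : ∀ i, A i ⟶ S.X₃)
    (hφ : ∀ i, φ i ≫ a (i + 1) = a i) (m : ℕ) (ha : ∀ i, m ≤ i → IsIso (a i))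
    (e₁ : ∀ i, A i ⟶ S.X₁) (hom_ext₁ : ∀ {Z : D} (f g : S.X₁ ⟶ Z),
      (∀ i, e₁ i ≫ f = e₁ i ≫ g) → f = g)
    (e₂ : ∀ i, A i ⟶ S.X₂) (h₂ : IsColimit (Cofan.mk S.X₂ e₂))
    (hf : ∀ i, e₁ i ≫ S.f = e₂ i - φ i ≫ e₂ (i + 1)) (hg : ∀ i, e₂ i ≫ S.g = a i) :
    Nonempty S.Splitting := by
  have isIso_φ (i : ℕ) (hi : m ≤ i) : IsIso (φ i) := by
    have := ha i hi
    have := ha (i + 1) (by lia)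
    have : IsIso (φ i ≫ a (i + 1)) := by rwa [hφ]
    exact IsIso.of_isIso_comp_right (φ i) (a (i + 1))
  have := ha m le_rfl
  obtain ⟨r, hr, hrm⟩ := exists_solution_of_isIso_ge m φ isIso_φ e₁
  let ρ : S.X₂ ⟶ S.X₁ := Cofan.IsColimit.desc h₂ r
  have hρ (i : ℕ) : e₂ i ≫ ρ = r i := Cofan.IsColimit.fac h₂ r i
  let σ : S.X₃ ⟶ S.X₂ := inv (a m) ≫ e₂ m
  have key (i : ℕ) : r i ≫ S.f + a i ≫ σ = e₂ i := by
    have step (i : ℕ) : r i ≫ S.f + a i ≫ σ - e₂ i =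
        φ i ≫ (r (i + 1) ≫ S.f + a (i + 1) ≫ σ - e₂ (i + 1)) := by
      simp only [hr i, ← hφ i, Preadditive.add_comp, Preadditive.comp_add, Preadditive.comp_sub,
        Category.assoc, hf]
      abel
    rw [← sub_eq_zero]
    have base : r m ≫ S.f + a m ≫ σ - e₂ m = 0 := by simp [hrm, σ]
    rcases le_total m i with hi | hi
    · induction i, hi using Nat.le_induction with
      | base => exact base
      | succ i hi ih =>
        have := isIso_φ i hi
        rwa [step, Preadditive.IsIso.comp_left_eq_zero] at ih
    · induction hi using Nat.decreasingInduction with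
      | of_succ i hi ih => rw [step, ih, comp_zero]
      | self => exact base
  refine ⟨{ r := ρ, s := σ, f_r := hom_ext₁ _ _ fun i => ?_, s_g := by simp [σ, hg],
            id := Cofan.IsColimit.hom_ext h₂ _ _ fun i => ?_ }⟩
  · rw [reassoc_of% hf i, Preadditive.sub_comp, Category.assoc, hρ, hρ, Category.comp_id, hr i,
      add_sub_cancel_right]
  · change e₂ i ≫ _ = e₂ i ≫ _
    rw [Preadditive.comp_add, reassoc_of% hρ i, reassoc_of% hg i, Category.comp_id, key]

/-- A sequence of cochain complexes that in each degree is eventually isomorphic to `X` yields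
a short exact sequence `⨁ T ⟶ ⨁ T ⟶ X`. -/
lemma seqMap_shortExact {X : CochainComplex C ℤ} (T : ℕ ⥤ CochainComplex C ℤ)
    (ι : T ⟶ (Functor.const ℕ).obj X)
    (h : ∀ n : ℤ, ∃ m : ℕ, ∀ i, m ≤ i → IsIso ((ι.app i).f n)) :
    (ShortComplex.mk _ _ (seqMap_comp_desc T ι)).ShortExact := by
  refine HomologicalComplex.shortExact_of_degreewise_shortExact _ fun n => ?_
  obtain ⟨m, hm⟩ := h n
  let hc := isColimitOfHasCoproductOfPreservesColimit
    (HomologicalComplex.eval C (ComplexShape.up ℤ) n) (fun i => T.obj i)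
  refine (nonempty_splitting_telescope _ (fun i => (T.map (homOfLE (Nat.le_succ i))).f n)
    (fun i => (ι.app i).f n) (fun i => ?_) m hm
    (fun i => (Sigma.ι (fun j => T.obj j) i).f n)
    (fun f g w => Cofan.IsColimit.hom_ext hc f g w)
    (fun i => (Sigma.ι (fun j => T.obj j) i).f n) hc (fun i => ?_)
    (fun i => ?_)).some.shortExact
  · have w : T.map (homOfLE (Nat.le_succ i)) ≫ ι.app (i + 1) = ι.app i := by
      simp
    exact congr_arg (fun f => f.f n) w
  · have w : Sigma.ι (fun j => T.obj j) i ≫ seqMap T = Sigma.ι (fun j => T.obj j) i -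
        T.map (homOfLE (Nat.le_succ i)) ≫ Sigma.ι (fun j => T.obj j) (i + 1) := by
      simp [seqMap]
    exact congr_arg (fun f => f.f n) w
  · have w : Sigma.ι (fun j => T.obj j) i ≫ Sigma.desc (fun j => ι.app j) = ι.app i :=
      Sigma.ι_desc _ _
    exact congr_arg (fun f => f.f n) w

/-- If countable coproducts exist and countable filtered colimits exist and are exact in
the abelian category `C`, the canonical morphism `hocolim τ_{≤ i}X ⟶ X` from the homotopy
colimit of the tower of canonical truncations of `X` is a quasi-isomorphism. -/
theorem hocolimTrunc_quasiIso
    [HasColimitsOfShape ℕ C]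
    (hexists : ∀ (J : Type) [SmallCategory J] [CountableCategory J] [IsFiltered J],
      HasColimitsOfShape J C)
    (hexact : ∀ (J : Type) [SmallCategory J] [CountableCategory J] [IsFiltered J]
      [HasColimitsOfShape J C], PreservesFiniteLimits (colim (J := J) (C := C)))
    (X : CochainComplex C ℤ)
    (T : ℕ ⥤ CochainComplex C ℤ) (ι : T ⟶ (Functor.const ℕ).obj X)
    -- `T.obj i` is the canonical truncation `τ_{≤ i}X` and `ι.app i` its inclusion into `X`:
    (h₁ : ∀ (i : ℕ) (n : ℤ), n < (i : ℤ) → IsIso ((ι.app i).f n))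
    (h₂ : ∀ (i : ℕ) (n : ℤ), (i : ℤ) < n → IsZero ((T.obj i).X n))
    (hw : ∀ i : ℕ, (ι.app i).f (i : ℤ) ≫ X.d (i : ℤ) ((i : ℤ) + 1) = 0)
    (h₃ : ∀ i : ℕ, Nonempty (IsLimit (KernelFork.ofι ((ι.app i).f (i : ℤ)) (hw i)))) :
    QuasiIso (hocolimTruncToSelf T ι) := by
  have hS := seqMap_shortExact T ι fun n =>
    ⟨(n + 1).toNat, fun i hi => h₁ i n (by lia)⟩
  have h := mappingCone.quasiIso_descShortComplex hS
  unfold mappingCone.descShortComplex at h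
  unfold hocolimTruncToSelf seqHocolim
  exact h

end
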